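/- Let q > 2 be a prime power and let a ∈ 𝔽_q be nonzero. Then, as permutations of 𝔽_q, Zieve's identity holds for the transposition (0,a): (0,a) = λ₁ ∘ ρ ∘ λ₂ ∘ ρ ∘ λ₂ ∘ ρ ∘ λ₃, where ρ is the permutation a ↦ a^{q−2}, λ₁ is x ↦ −ax + a, λ₂ is x ↦ −x + 1, and λ₃ is x ↦ x/a. -/

import Mathlib

theorem FiniteField.pow_card_sub_two_eq_inv {F : Type*} [Field F] [Fintype F]
    (hq : 2 < Fintype.card F) (x : F) : x ^ (Fintype.card F - 2) = x⁻¹ := by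
  rcases eq_or_ne x 0 with rfl | hx
  · rw [zero_pow (by omega), inv_zero]
  · refine eq_inv_of_mul_eq_one_left ?_
    rw [← pow_succ, show Fintype.card F - 2 + 1 = Fintype.card F - 1 by omega]
    exact FiniteField.pow_card_sub_one_eq_one x hx

/-- Zieve's identity: for nonzero a ∈ 𝔽_q, as permutations of 𝔽_q,
(0,a) = λ₁ ∘ ρ ∘ λ₂ ∘ ρ ∘ λ₂ ∘ ρ ∘ λ₃, where ρ : x ↦ x^{q−2}, λ₁ : x ↦ −ax + a,
λ₂ : x ↦ −x + 1, and λ₃ : x ↦ x/a. -/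
theorem zieve_identity
    {F : Type*} [Field F] [Fintype F] [DecidableEq F]
    (hq : 2 < Fintype.card F)
    (a : F) (ha : a ≠ 0)
    (ρ : Equiv.Perm F) (hρ : ∀ x : F, ρ x = x ^ (Fintype.card F - 2))
    (lam₁ : Equiv.Perm F) (hlam₁ : ∀ x : F, lam₁ x = -a * x + a)
    (lam₂ : Equiv.Perm F) (hlam₂ : ∀ x : F, lam₂ x = -x + 1)
    (lam₃ : Equiv.Perm F) (hlam₃ : ∀ x : F, lam₃ x = x / a) :
    Equiv.swap (0 : F) a = lam₁ * ρ * lam₂ * ρ * lam₂ * ρ * lam₃ := by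
  ext x
  simp only [Equiv.Perm.mul_apply, hlam₁, hlam₂, hlam₃, hρ,
    FiniteField.pow_card_sub_two_eq_inv hq]
  rcases eq_or_ne x 0 with rfl | hx
  · simp
  rcases eq_or_ne x a with rfl | hxa
  · simp [hx]
  rw [Equiv.swap_apply_of_ne_of_ne hx hxa]
  have hsub : x - a ≠ 0 := sub_ne_zero.mpr hxa
  have h₁ : -(x / a)⁻¹ + 1 = (x - a) / x := by
    field_simp
    ring
  have h₂ : -((x - a) / x)⁻¹ + 1 = -a / (x - a) := by
    field_simp
    ring
  rw [h₁, h₂]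
  field_simp
  ring
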